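/- Let G be a 2-connected o-heavy non-Hamiltonian graph on n vertices, C a longest heavy cycle with a fixed orientation, P a path between v_1, v_2 ∈ V(C) with all internal vertices outside C, let y_1 be the first vertex on the arc of C from v_1 to v_2 (following the orientation) nonadjacent to v_1, and y_2 the first vertex on the arc from v_2 to v_1 nonadjacent to v_2. Then for every internal vertex u of P, every w_1 on the arc from v_1⁺ to y_1, and every w_2 on the arc from v_2⁺ to y_2: {u, w_1} ∉ Ẽ(G), {u, w_2} ∉ Ẽ(G), {v_1, w_2} ∉ Ẽ(G), {v_2, w_1} ∉ Ẽ(G), and {w_1, w_2} ∉ Ẽ(G). -/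

import Mathlib

open SimpleGraph

/-- `{x, y}` is an Ore-edge of `G`: either an actual edge, or a pair of distinct
vertices with degree sum at least `n`. -/
def OreEdge {V : Type*} [Fintype V] (G : SimpleGraph V) [DecidableRel G.Adj]
    (x y : V) : Prop :=
  x ≠ y ∧ (G.Adj x y ∨ Fintype.card V ≤ G.degree x + G.degree y)

/-- The cycle `C = f 0, f 1, …, f (m-1), f 0` in `G`, with the orientation given
by increasing indices (so `f (i+1)` is the successor and `f (i-1)` the
predecessor of `f i` on `C`). -/
def IsCycleEmbedding {V : Type*} (G : SimpleGraph V) (m : ℕ) (f : ZMod m → V) : Prop :=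
  3 ≤ m ∧ Function.Injective f ∧ ∀ i : ZMod m, G.Adj (f i) (f (i + 1))

/-- `f` describes a longest cycle of `G` (of length `m`). -/
def IsLongestCycle {V : Type*} (G : SimpleGraph V) (m : ℕ) (f : ZMod m → V) : Prop :=
  IsCycleEmbedding G m f ∧
  ∀ (u : V) (C : G.Walk u u), C.IsCycle → C.length ≤ m

/-- `R` is a connected component of `G - V(C)`, where `C` is the cycle given
by `f`: `R` is a nonempty set of vertices off `C`, connected in the induced
subgraph, and closed under adjacency to vertices off `C`. -/
def IsComponentOutside {V : Type*} (G : SimpleGraph V) (m : ℕ) (f : ZMod m → V)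
    (R : Set V) : Prop :=
  R.Nonempty ∧ (∀ x ∈ R, x ∉ Set.range f) ∧ (G.induce R).Connected ∧
  ∀ x ∈ R, ∀ y : V, G.Adj x y → y ∉ Set.range f → y ∈ R

/-- `G` is 2-connected. -/
def TwoConnected {V : Type*} [Fintype V] (G : SimpleGraph V) : Prop :=
  3 ≤ Fintype.card V ∧ ∀ v : V, (G.induce {w | w ≠ v}).Connected

/-- `c, a, b, d` form an induced claw in `G` with center `c`. -/
def IsInducedClaw {V : Type*} (G : SimpleGraph V) (c a b d : V) : Prop :=
  a ≠ b ∧ a ≠ d ∧ b ≠ d ∧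
  G.Adj c a ∧ G.Adj c b ∧ G.Adj c d ∧
  ¬G.Adj a b ∧ ¬G.Adj a d ∧ ¬G.Adj b d

/-- `G` is o-heavy. -/
def OHeavy {V : Type*} [Fintype V] (G : SimpleGraph V) [DecidableRel G.Adj] : Prop :=
  ∀ c a b d : V, IsInducedClaw G c a b d →
    Fintype.card V ≤ G.degree a + G.degree b ∨
    Fintype.card V ≤ G.degree a + G.degree d ∨
    Fintype.card V ≤ G.degree b + G.degree d

/-- The `n` consecutive vertices of the cycle `f` starting `a` steps after `f i`. -/
def cycleArc {V : Type*} {m : ℕ} (f : ZMod m → V) (i : ZMod m) (a n : ℕ) : List V :=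
  (List.range' a n).map fun k : ℕ => f (i + k)

section Arcs

variable {V : Type*} {m : ℕ} {f : ZMod m → V}

theorem cycleArc_append (i : ZMod m) (a n k : ℕ) :
    cycleArc f i a n ++ cycleArc f i (a + n) k = cycleArc f i a (n + k) := by
  rw [cycleArc, cycleArc, cycleArc, ← List.map_append, List.range'_append_1]

theorem cycleArc_shift (i : ZMod m) (d a n : ℕ) :
    cycleArc f (i + d) a n = cycleArc f i (d + a) n := by
  simp only [cycleArc, ← List.map_add_range', List.map_map]
  refine List.map_congr_left fun k _ => ?_
  simp [add_assoc]

theorem length_cycleArc (i : ZMod m) (a n : ℕ) : (cycleArc f i a n).length = n := by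
  simp [cycleArc]

theorem mem_range_of_mem_cycleArc {i : ZMod m} {a n : ℕ} {x : V} (h : x ∈ cycleArc f i a n) :
    x ∈ Set.range f := by
  obtain ⟨k, -, rfl⟩ := List.mem_map.1 h
  exact ⟨_, rfl⟩

theorem nodup_cycleArc (hf : Function.Injective f) (i : ZMod m) (a : ℕ) :
    (cycleArc f i a m).Nodup := by
  refine List.Nodup.map_on ?_ List.nodup_range'
  intro x hx y hy hxy
  have := (ZMod.natCast_eq_natCast_iff' _ _ _).1 (add_left_cancel (hf hxy))
  rw [List.mem_range'_1] at hx hy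
  have h := Nat.ModEq.eq_of_abs_lt (m := m) this (by rw [abs_lt]; omega)
  exact h

end Arcs

/-- A path of Ore-edges of `G` from the first to the second endpoint, visiting the given list of
vertices in order, of which at most the given number of steps may fail to be edges of `G`. -/
inductive OrePath {V : Type*} [Fintype V] (G : SimpleGraph V) [DecidableRel G.Adj] :
    V → List V → V → ℕ → Prop
  | single (a : V) : OrePath G a [a] a 0
  | cons {a b c : V} {l : List V} {k : ℕ} :
      G.Adj a b → OrePath G b l c k → OrePath G a (a :: l) c k
  | consOre {a b c : V} {l : List V} {k : ℕ} :
      OreEdge G a b → OrePath G b l c k → OrePath G a (a :: l) c (k + 1)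

section OrePaths

variable {V : Type*} [Fintype V] {G : SimpleGraph V} [DecidableRel G.Adj]

theorem OreEdge.symm {x y : V} (h : OreEdge G x y) : OreEdge G y x :=
  ⟨h.1.symm, h.2.imp (·.symm) fun h => by omega⟩

theorem OreEdge.of_adj {x y : V} (h : G.Adj x y) : OreEdge G x y :=
  ⟨h.ne, Or.inl h⟩

namespace OrePath

theorem append {a b c d : V} {l l' : List V} {j k : ℕ} (h : OrePath G a l b j)
    (hbc : G.Adj b c) (h' : OrePath G c l' d k) : OrePath G a (l ++ l') d (j + k) := by
  induction h with
  | single a => simpa using OrePath.cons hbc h'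
  | cons hab _ ih => exact .cons hab (ih hbc)
  | consOre hab _ ih => rw [Nat.add_right_comm]; exact .consOre hab (ih hbc)

theorem append_ore {a b c d : V} {l l' : List V} {j k : ℕ} (h : OrePath G a l b j)
    (hbc : OreEdge G b c) (h' : OrePath G c l' d k) :
    OrePath G a (l ++ l') d (j + k + 1) := by
  induction h with
  | single a => simpa using OrePath.consOre hbc h'
  | cons hab _ ih => exact .cons hab (ih hbc)
  | consOre hab _ ih => rw [Nat.add_right_comm _ 1]; exact .consOre hab (ih hbc)

theorem reverse {a b : V} {l : List V} {k : ℕ} (h : OrePath G a l b k) :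
    OrePath G b l.reverse a k := by
  induction h with
  | single a => exact .single a
  | cons hab _ ih => simpa using ih.append hab.symm (.single _)
  | consOre hab _ ih => simpa using ih.append_ore hab.symm (.single _)

/-- An Ore-path that is not a path of `G` can be cut at a step that is not an edge of `G`. -/
theorem eq_zero_or_split {a b : V} {l : List V} {k : ℕ} (h : OrePath G a l b k) :
    k = 0 ∨ ∃ l₁ l₂ c d j₁ j₂, l = l₁ ++ l₂ ∧ OrePath G a l₁ c j₁ ∧ OreEdge G c d ∧
      OrePath G d l₂ b j₂ ∧ k = j₁ + j₂ + 1 := by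
  induction h with
  | single a => exact .inl rfl
  | @cons a b c l k hab h ih =>
    obtain rfl | ⟨l₁, l₂, c', d, j₁, j₂, rfl, h₁, hcd, h₂, rfl⟩ := ih
    · exact .inl rfl
    · exact .inr ⟨a :: l₁, l₂, c', d, j₁, j₂, rfl, .cons hab h₁, hcd, h₂, rfl⟩
  | @consOre a b c l k hab h ih =>
    exact .inr ⟨[a], l, a, b, 0, k, rfl, .single a, hab, h, by omega⟩

/-- Either some two consecutive vertices `c, d` of an Ore-path satisfy `p c` and `q d`, or
the path has few vertices satisfying `p` or `q`. -/
theorem crossing_or_countP_le (p q : V → Prop) [DecidablePred p] [DecidablePred q]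
    {a b : V} {l : List V} {k : ℕ} (h : OrePath G a l b k) :
    (∃ l₁ l₂ c d j₁ j₂, l = l₁ ++ l₂ ∧ OrePath G a l₁ c j₁ ∧ OrePath G d l₂ b j₂ ∧
      j₁ + j₂ ≤ k ∧ p c ∧ q d) ∨
    l.countP (fun v => p v) + l.countP (fun v => q v) + 1 ≤
      l.length + (if p b then 1 else 0) + (if q a then 1 else 0) := by
  induction h with
  | single a =>
    right
    simp only [List.countP_cons, List.countP_nil, List.length_singleton, decide_eq_true_eq]
    omega
  | @cons a b c l k hab h ih =>
    by_cases hpq : p a ∧ q b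
    · exact .inl ⟨[a], l, a, b, 0, k, rfl, .single a, h, by omega, hpq.1, hpq.2⟩
    obtain ⟨l₁, l₂, c', d, j₁, j₂, rfl, h₁, h₂, hj, hp, hq⟩ | ih := ih
    · exact .inl ⟨a :: l₁, l₂, c', d, j₁, j₂, rfl, .cons hab h₁, h₂, hj, hp, hq⟩
    · right
      simp only [List.countP_cons, List.length_cons, decide_eq_true_eq]
      by_cases h1 : p a <;> by_cases h2 : q b <;> simp_all <;> omega
  | @consOre a b c l k hab h ih =>
    by_cases hpq : p a ∧ q b
    · exact .inl ⟨[a], l, a, b, 0, k, rfl, .single a, h, by omega, hpq.1, hpq.2⟩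
    obtain ⟨l₁, l₂, c', d, j₁, j₂, rfl, h₁, h₂, hj, hp, hq⟩ | ih := ih
    · exact .inl ⟨a :: l₁, l₂, c', d, j₁ + 1, j₂, rfl, .consOre hab h₁, h₂, by omega, hp, hq⟩
    · right
      simp only [List.countP_cons, List.length_cons, decide_eq_true_eq]
      by_cases h1 : p a <;> by_cases h2 : q b <;> simp_all <;> omega

theorem exists_walk {a b : V} {l : List V} (h : OrePath G a l b 0) :
    ∃ w : G.Walk a b, w.support = l := by
  generalize hk : 0 = k at h
  induction h with
  | single a => exact ⟨.nil, rfl⟩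
  | cons hab _ ih =>
    obtain ⟨w, rfl⟩ := ih hk
    exact ⟨.cons hab w, rfl⟩
  | consOre => omega

/-- If the ends of an Ore-path are nonadjacent with degree sum at least `n`, its vertices lie on
a closed Ore-path whose closing step is an edge, with no more steps outside `G` along it. -/
theorem exists_closed [DecidableEq V] {a b : V} {l : List V} {k : ℕ} (h : OrePath G a l b k)
    (hl : l.Nodup) (hdeg : Fintype.card V ≤ G.degree a + G.degree b) :
    ∃ l' a' b' k', OrePath G a' l' b' k' ∧ l'.Nodup ∧ l.length ≤ l'.length ∧ k' ≤ k ∧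
      G.Adj b' a' := by
  by_cases hz : ∃ z, z ∉ l ∧ G.Adj a z ∧ G.Adj b z
  · obtain ⟨z, hzl, haz, hbz⟩ := hz
    exact ⟨z :: l, z, b, k, .cons haz.symm h, List.nodup_cons.2 ⟨hzl, hl⟩, by simp, le_rfl, hbz⟩
  push Not at hz
  obtain ⟨l₁, l₂, c, d, j₁, j₂, rfl, h₁, h₂, hj, hc, hd⟩ | hcount :=
    h.crossing_or_countP_le (G.Adj b) (G.Adj a)
  · refine ⟨l₁ ++ l₂.reverse, a, d, j₁ + j₂, h₁.append hc.symm h₂.reverse, ?_, by simp, hj,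
      hd.symm⟩
    exact (List.Perm.append_left _ (List.reverse_perm l₂)).nodup_iff.2 hl
  · exfalso
    have key (x : V) : G.degree x =
        l.countP (fun v => G.Adj x v) + (G.neighborFinset x \ l.toFinset).card := by
      rw [← G.card_neighborFinset_eq_degree, ← Finset.card_inter_add_card_sdiff _ l.toFinset,
        List.countP_eq_length_filter, ← List.toFinset_card_of_nodup (hl.filter _)]
      congr 2
      ext v
      simp [and_comm]
    have hdisj : Disjoint (G.neighborFinset a \ l.toFinset) (G.neighborFinset b \ l.toFinset) := by
      rw [Finset.disjoint_left]
      intro v hv hv'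
      simp only [Finset.mem_sdiff, mem_neighborFinset, List.mem_toFinset] at hv hv'
      exact hz v hv.2 hv.1 hv'.1
    have hsub : (G.neighborFinset a \ l.toFinset) ∪ (G.neighborFinset b \ l.toFinset) ⊆
        l.toFinsetᶜ := by
      intro v
      simp only [Finset.mem_union, Finset.mem_sdiff, Finset.mem_compl]
      tauto
    have hcard := Finset.card_le_card hsub
    rw [Finset.card_union_of_disjoint hdisj, Finset.card_compl,
      List.toFinset_card_of_nodup hl] at hcard
    have hle : l.length ≤ Fintype.card V := hl.length_le_card
    have ha := key a
    have hb := key b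
    simp only [SimpleGraph.irrefl, if_false] at hcount
    omega

/-- Every closed Ore-path on at least three vertices yields a cycle on at least as many vertices. -/
theorem exists_isCycle [DecidableEq V] {a b : V} {l : List V} {k : ℕ} (h : OrePath G a l b k)
    (hl : l.Nodup) (h3 : 3 ≤ l.length) (hba : OreEdge G b a) :
    ∃ (v : V) (C : G.Walk v v), C.IsCycle ∧ l.length ≤ C.length := by
  have main : ∀ (K : ℕ) (a b : V) (l : List V) (k : ℕ), OrePath G a l b k → l.Nodup →
      3 ≤ l.length → (G.Adj b a ∧ k ≤ K ∨ OreEdge G b a ∧ k + 1 ≤ K) →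
      ∃ (v : V) (C : G.Walk v v), C.IsCycle ∧ l.length ≤ C.length := by
    intro K
    induction K with
    | zero =>
      intro a b l k h hl h3 hK
      obtain ⟨hba, hk⟩ | ⟨_, hk⟩ := hK
      · obtain rfl : k = 0 := by omega
        obtain ⟨w, rfl⟩ := h.exists_walk
        have hw : w.IsPath := w.isPath_def.2 hl
        rw [Walk.length_support] at h3
        refine ⟨b, .cons hba w, (Walk.cons_isCycle_iff w hba).2 ⟨hw, fun hmem => ?_⟩, by simp⟩
        have := hw.length_eq_one_of_mem_edges (Sym2.eq_swap ▸ hmem)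
        omega
      · omega
    | succ K ih =>
      have closing : ∀ (a b : V) (l : List V) (k : ℕ), OrePath G a l b k → l.Nodup →
          3 ≤ l.length → OreEdge G b a → k ≤ K →
          ∃ (v : V) (C : G.Walk v v), C.IsCycle ∧ l.length ≤ C.length := by
        intro a b l k h hl h3 hba hk
        obtain hadj | hdeg := hba.2
        · exact ih a b l k h hl h3 (.inl ⟨hadj, hk⟩)
        obtain ⟨l', a', b', k', h', hl', hlen, hk', hadj⟩ := h.exists_closed hl (by omega)
        obtain ⟨v, C, hC, hlC⟩ := ih a' b' l' k' h' hl' (by omega) (.inl ⟨hadj, by omega⟩)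
        exact ⟨v, C, hC, hlen.trans hlC⟩
      intro a b l k h hl h3 hK
      obtain ⟨hba, hk⟩ | ⟨hba, hk⟩ := hK
      · obtain rfl | ⟨l₁, l₂, c, d, j₁, j₂, rfl, h₁, hcd, h₂, rfl⟩ := h.eq_zero_or_split
        · exact ih a b l 0 h hl h3 (.inl ⟨hba, by omega⟩)
        · have hp : (l₂ ++ l₁).Perm (l₁ ++ l₂) := List.perm_append_comm
          rw [← hp.length_eq] at h3 ⊢
          exact closing d c _ _ (h₂.append hba h₁) (hp.nodup_iff.2 hl) h3 hcd (by omega)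
      · exact closing a b l k h hl h3 hba (by omega)
  exact main (k + 1) a b l k h hl h3 (.inr ⟨hba, le_rfl⟩)

end OrePath

/-- The list is the sequence of vertices of a path of Ore-edges between the two vertices. -/
def OreLinked {V : Type*} [Fintype V] (G : SimpleGraph V) [DecidableRel G.Adj]
    (a : V) (l : List V) (b : V) : Prop :=
  ∃ k, OrePath G a l b k

namespace OreLinked

theorem single (a : V) : OreLinked G a [a] a := ⟨0, .single a⟩

theorem append {a b c d : V} {l l' : List V} (h : OreLinked G a l b) (hbc : OreEdge G b c)
    (h' : OreLinked G c l' d) : OreLinked G a (l ++ l') d :=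
  ⟨_, h.choose_spec.append_ore hbc h'.choose_spec⟩

theorem reverse {a b : V} {l : List V} (h : OreLinked G a l b) : OreLinked G b l.reverse a :=
  ⟨_, h.choose_spec.reverse⟩

theorem cons {a b c : V} {l : List V} (hab : OreEdge G a b) (h : OreLinked G b l c) :
    OreLinked G a (a :: l) c :=
  (single a).append hab h

theorem walk_support {a b : V} (w : G.Walk a b) : OreLinked G a w.support b := by
  induction w with
  | nil => exact single _
  | cons h w ih => exact ih.cons (.of_adj h)

theorem exists_support_eq_cons {a b : V} (w : G.Walk a b) (hab : a ≠ b) :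
    ∃ (c : V) (l : List V), G.Adj a c ∧ OreLinked G c l b ∧ w.support = a :: l := by
  cases w with
  | nil => exact absurd rfl hab
  | cons h w => exact ⟨_, w.support, h, walk_support w, rfl⟩

end OreLinked

theorem oreLinked_cycleArc {m : ℕ} {f : ZMod m → V}
    (hf : ∀ i, G.Adj (f i) (f (i + 1))) (i : ZMod m) (a n : ℕ) :
    OreLinked G (f (i + a)) (cycleArc f i a (n + 1)) (f (i + (a + n : ℕ))) := by
  induction n generalizing a with
  | zero => exact .single _
  | succ n ih =>
    have h := (ih (a + 1)).cons (a := f (i + a))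
      (.of_adj (by simpa [add_assoc] using hf (i + a)))
    rw [Nat.add_right_comm a 1 n] at h
    simpa [cycleArc, List.range'_succ, add_assoc, add_comm, add_left_comm] using h

/-- A closed Ore-path through a longest cycle cannot pass through further vertices. -/
theorem IsLongestCycle.not_oreEdge [DecidableEq V] {m : ℕ} {f : ZMod m → V}
    (hC : IsLongestCycle G m f) (i : ZMod m) {a b : V} {l I : List V} (hI : I ≠ [])
    (hnd : I.Nodup) (hoff : ∀ x ∈ I, x ∉ Set.range f) (hperm : l.Perm (cycleArc f i 0 m ++ I))
    (h : OreLinked G a l b) : ¬OreEdge G b a := by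
  intro hba
  obtain ⟨k, h⟩ := h
  have hlen := hperm.length_eq
  rw [List.length_append, length_cycleArc] at hlen
  have hpos := List.length_pos_iff.2 hI
  have hl : l.Nodup := hperm.nodup_iff.2 <| (nodup_cycleArc hC.1.2.1 i 0).append hnd
    fun x hx hxI => hoff x hxI (mem_range_of_mem_cycleArc hx)
  obtain ⟨v, C, hcyc, hle⟩ := h.exists_isCycle hl (by have := hC.1.1; omega) hba
  have := hC.2 v C hcyc
  omega

/-- In an o-heavy graph, the two neighbours along a longest cycle of a vertex with a neighbour
outside the cycle form an Ore-edge. -/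
theorem IsLongestCycle.oreEdge_pred_succ [DecidableEq V] {m : ℕ} {f : ZMod m → V}
    (hC : IsLongestCycle G m f) (hoh : OHeavy G) {i : ZMod m} {x : V} (hx : x ∉ Set.range f)
    (hix : G.Adj (f i) x) : OreEdge G (f (i - 1)) (f (i + 1)) := by
  have h3 := hC.1.1
  have hadj := hC.1.2.2
  have hpred : G.Adj (f (i - 1)) (f i) := by simpa using hadj (i - 1)
  have hlink (j : ZMod m) : OreLinked G (f j) (cycleArc f j 0 m) (f (j - 1)) := by
    obtain ⟨n, rfl⟩ : ∃ n, m = n + 1 := ⟨m - 1, by omega⟩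
    have hn : ((n : ℕ) : ZMod (n + 1)) = -1 := by
      rw [eq_neg_iff_add_eq_zero]; exact_mod_cast ZMod.natCast_self (n + 1)
    have h := oreLinked_cycleArc hadj j 0 n
    rw [Nat.zero_add, hn] at h
    simpa [sub_eq_add_neg] using h
  have hsucc_x : ¬OreEdge G x (f (i + 1)) := fun h => by
    have hl := (hlink (i + 1)).append (.of_adj (by simpa using hix)) (.single x)
    exact hC.not_oreEdge (i + 1) (by simp) (by simp) (by simpa using hx) (.refl _) hl h
  have hpred_x : ¬OreEdge G (f (i - 1)) x := fun h => by
    have hl := (hlink i).append h (.single x)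
    exact hC.not_oreEdge i (by simp) (by simp) (by simpa using hx) (.refl _) hl
      (.of_adj hix.symm)
  have hne : f (i - 1) ≠ f (i + 1) := fun h => by
    have h2 : ((2 : ℕ) : ZMod m) = 0 := by
      have := hC.1.2.1 h
      push_cast
      linear_combination -this
    have := Nat.le_of_dvd (by norm_num) ((ZMod.natCast_eq_zero_iff _ _).1 h2)
    omega
  have hxne (j : ZMod m) : f j ≠ x := fun h => hx ⟨j, h⟩
  refine ⟨hne, or_iff_not_imp_left.2 fun hnadj => ?_⟩
  obtain h | h | h := hoh (f i) (f (i - 1)) (f (i + 1)) x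
    ⟨hne, hxne _, hxne _, hpred.symm, hadj i, hix, hnadj,
      fun h => hpred_x (.of_adj h), fun h => hsucc_x (.of_adj h.symm)⟩
  · exact h
  · exact absurd ⟨hxne _, .inr h⟩ hpred_x
  · exact absurd ⟨(hxne _).symm, .inr (by omega)⟩ hsucc_x

/-- If `f i` is adjacent to its first `s - 1` successors on the cycle, then these can be visited
right before `f i`. -/
theorem exists_oreLinked_reroute {m : ℕ} {f : ZMod m → V}
    (hf : ∀ i, G.Adj (f i) (f (i + 1))) {i : ZMod m} (hi : OreEdge G (f (i - 1)) (f (i + 1)))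
    {s : ℕ} (hs : 1 ≤ s) (h : ∀ s' : ℕ, 1 ≤ s' → s' < s → G.Adj (f i) (f (i + s'))) :
    ∃ (x : V) (L : List V), OreLinked G x L (f i) ∧
      L.Perm (f i :: cycleArc f i 1 (s - 1)) ∧ OreEdge G (f (i - 1)) x := by
  obtain rfl | ⟨r, rfl⟩ : s = 1 ∨ ∃ r, s = r + 2 := by
    obtain rfl | h1 := hs.eq_or_lt
    · exact .inl rfl
    · exact .inr ⟨s - 2, by omega⟩
  · exact ⟨f i, [f i], .single _, .refl _, .of_adj (by simpa using hf (i - 1))⟩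
  · refine ⟨f (i + 1), cycleArc f i 1 (r + 1) ++ [f i], ?_, List.perm_append_singleton _ _, hi⟩
    have h1 := oreLinked_cycleArc hf i 1 r
    rw [Nat.cast_one] at h1
    exact h1.append (.of_adj (h (1 + r) (by omega) (by omega)).symm) (.single _)

/-- The arc of the cycle from the successor of `f i` to the predecessor of `f j`. -/
theorem oreLinked_cycleArc_pred {m : ℕ} {f : ZMod m → V} (hf : ∀ i, G.Adj (f i) (f (i + 1)))
    {i j : ZMod m} {d : ℕ} (hd : j = i + d) {a : ℕ} (ha : a < d) :
    OreLinked G (f (i + a)) (cycleArc f i a (d - a)) (f (j - 1)) := by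
  obtain ⟨q, rfl⟩ : ∃ q, d = a + q + 1 := ⟨d - a - 1, by omega⟩
  have h := oreLinked_cycleArc hf i a q
  rw [show a + q + 1 - a = q + 1 by omega, show j - 1 = i + (a + q : ℕ) by
    rw [hd]; push_cast; ring]
  exact h

theorem cycleArc_eq_append {V : Type*} {m : ℕ} (f : ZMod m → V) {i j : ZMod m} {d e N : ℕ}
    (hd : j = i + d) (hN : d + e = N) :
    cycleArc f i 0 N = cycleArc f i 0 d ++ cycleArc f j 0 e := by
  rw [hd, ← hN, cycleArc_shift, Nat.add_zero, ← cycleArc_append, Nat.zero_add]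

theorem cycleArc_eq_cons_append {V : Type*} {m : ℕ} (f : ZMod m → V) (i : ZMod m) {d s : ℕ}
    (hs : 1 ≤ s) (hsd : s < d) :
    cycleArc f i 0 d = f i :: cycleArc f i 1 (s - 1) ++ cycleArc f i s (d - s) := by
  have h1 : f i :: cycleArc f i 1 (s - 1) = cycleArc f i 0 s := by
    obtain ⟨r, rfl⟩ : ∃ r, s = r + 1 := ⟨s - 1, by omega⟩
    simp [cycleArc, List.range'_succ]
  have h2 := cycleArc_append (f := f) i 0 s (d - s)
  rw [Nat.zero_add, Nat.add_sub_cancel' hsd.le] at h2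
  rw [h1, h2]

/-- A vertex of a longest cycle joined to `f j` by a path off the cycle is not adjacent to the
predecessor of `f j`. -/
theorem IsLongestCycle.not_adj_pred [DecidableEq V] {m : ℕ} {f : ZMod m → V}
    (hC : IsLongestCycle G m f) {i j : ZMod m} {d e : ℕ} (hd : j = i + d) (he : i = j + e)
    (hde : d + e = m) (hd2 : 2 ≤ d) (he1 : 1 ≤ e)
    (hi : OreEdge G (f (i - 1)) (f (i + 1)))
    {a b : V} {I : List V} (hI : I ≠ []) (hnd : I.Nodup) (hoff : ∀ x ∈ I, x ∉ Set.range f)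
    (hia : G.Adj (f i) a) (hlink : OreLinked G a I b) (hbj : G.Adj b (f j)) :
    ¬G.Adj (f i) (f (j - 1)) := by
  intro hadj
  have h1 := oreLinked_cycleArc_pred hC.1.2.2 hd (a := 1) (by omega)
  have h2 := oreLinked_cycleArc_pred hC.1.2.2 he (a := 0) (by omega)
  rw [Nat.cast_one] at h1
  rw [Nat.cast_zero, add_zero, Nat.sub_zero] at h2
  have h := h1.append (.of_adj hadj.symm)
    (((OreLinked.single (f i)).append (.of_adj hia) hlink).append (.of_adj hbj) h2)
  refine hC.not_oreEdge i hI hnd hoff ?_ h hi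
  rw [cycleArc_eq_append f hd hde, cycleArc_eq_cons_append f i (s := 1) le_rfl (by omega),
    List.perm_iff_count]
  intro x
  simp [cycleArc, List.count_cons, List.count_append]
  omega

/-- The Ore-edges excluded by the presence of a path off a longest cycle between `f i` and
`f j`, up to exchanging `i` and `j`. -/
theorem IsLongestCycle.not_oreEdge_of_path [DecidableEq V] {m : ℕ} {f : ZMod m → V}
    (hC : IsLongestCycle G m f) {i j : ZMod m} {d e : ℕ} (hd : j = i + d) (he : i = j + e)
    (hde : d + e = m)
    (hi : OreEdge G (f (i - 1)) (f (i + 1))) (hj : OreEdge G (f (j - 1)) (f (j + 1)))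
    {a b : V} {I : List V} (hI : I ≠ []) (hnd : I.Nodup) (hoff : ∀ x ∈ I, x ∉ Set.range f)
    (hia : G.Adj (f i) a) (hlink : OreLinked G a I b) (hbj : G.Adj b (f j))
    {c u : V} {J : List V} (hJ : J ≠ []) (hndJ : J.Nodup) (hoffJ : ∀ x ∈ J, x ∉ Set.range f)
    (hic : G.Adj (f i) c) (hlinkJ : OreLinked G c J u)
    {s t : ℕ} (hs : 1 ≤ s) (hsd : s < d) (ht : 1 ≤ t) (hte : t < e)
    (hs' : ∀ k : ℕ, 1 ≤ k → k < s → G.Adj (f i) (f (i + k)))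
    (ht' : ∀ k : ℕ, 1 ≤ k → k < t → G.Adj (f j) (f (j + k))) :
    ¬OreEdge G u (f (i + s)) ∧ ¬OreEdge G (f i) (f (j + t)) ∧
      ¬OreEdge G (f (i + s)) (f (j + t)) := by
  have hf := hC.1.2.2
  obtain ⟨x, L, hL, hLperm, hx⟩ := exists_oreLinked_reroute hf hi hs hs'
  obtain ⟨y, M, hM, hMperm, hy⟩ := exists_oreLinked_reroute hf hj ht ht'
  have hB₁ := oreLinked_cycleArc_pred hf hd hsd
  have hB₂ := oreLinked_cycleArc_pred hf he hte
  have hAB₁ := oreLinked_cycleArc_pred hf hd (a := 1) (by omega)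
  have hvAB₂ := oreLinked_cycleArc_pred hf he (a := 0) (by omega)
  rw [Nat.cast_one] at hAB₁
  rw [Nat.cast_zero, add_zero, Nat.sub_zero] at hvAB₂
  have hpredj : OreEdge G (f (j - 1)) (f j) := .of_adj (by simpa using hf (j - 1))
  have hK₁ := cycleArc_eq_cons_append f i hs hsd
  have hK₁' := cycleArc_eq_cons_append f i (s := 1) (d := d) le_rfl (by omega)
  have hK₂ := cycleArc_eq_cons_append f j ht hte
  have hK : cycleArc f i 0 m = cycleArc f i 0 d ++ cycleArc f j 0 e :=
    cycleArc_eq_append f hd hde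
  rw [List.perm_iff_count] at hLperm hMperm
  refine ⟨fun h => ?_, fun h => ?_, fun h => ?_⟩
  · have h' := (hB₁.append hpredj hvAB₂).append hx (hL.append (.of_adj hic) hlinkJ)
    refine hC.not_oreEdge i hJ hndJ hoffJ (List.perm_iff_count.2 fun z => ?_) h' h
    have := hLperm z
    rw [hK, hK₁]
    simp only [List.count_append] at this ⊢
    omega
  · have h' := (hAB₁.append hy (hM.append (.of_adj hbj.symm) hlink.reverse)).append
      (.of_adj hia.symm) ((OreLinked.single (f i)).append h hB₂)
    refine hC.not_oreEdge i hI hnd hoff (List.perm_iff_count.2 fun z => ?_) h' hi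
    have := hMperm z
    rw [hK, hK₁', hK₂]
    simp only [List.count_append, List.count_reverse, List.count_cons, List.count_nil,
      Nat.sub_self, cycleArc, List.range'_zero, List.map_nil] at this ⊢
    omega
  · have h' := (hB₁.append hy (hM.append (.of_adj hbj.symm) hlink.reverse)).append
      (.of_adj hia.symm) (hL.reverse.append hx.symm hB₂.reverse)
    refine hC.not_oreEdge i hI hnd hoff (List.perm_iff_count.2 fun z => ?_) h' h.symm
    have h₁ := hLperm z
    have h₂ := hMperm z
    rw [hK, hK₁, hK₂]
    simp only [List.count_append, List.count_reverse] at h₁ h₂ ⊢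
    omega

/-- The part of a path from its second vertex up to a vertex `u` other than its ends. -/
theorem exists_oreLinked_of_mem_support [DecidableEq V] {S : Set V} {x y u : V} (p : G.Walk x y)
    (hp : p.IsPath) (hint : ∀ z ∈ p.support, z ≠ x → z ≠ y → z ∉ S) (hu : u ∈ p.support)
    (hux : u ≠ x) (huy : u ≠ y) :
    ∃ (c : V) (J : List V), G.Adj x c ∧ OreLinked G c J u ∧ J ≠ [] ∧ J.Nodup ∧
      ∀ z ∈ J, z ∉ S := by
  obtain ⟨c, J, hxc, hlink, hsupp⟩ := OreLinked.exists_support_eq_cons (p.takeUntil u hu) hux.symm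
  have hnd := (hp.takeUntil hu).support_nodup
  have hlast := (p.takeUntil u hu).end_mem_support
  have hy := Walk.endpoint_notMem_support_takeUntil hp hu huy.symm
  have hsub := p.support_takeUntil_subset_support hu
  rw [hsupp] at hnd hlast hy hsub
  obtain ⟨hxJ, hnd⟩ := List.nodup_cons.1 hnd
  refine ⟨c, J, hxc, hlink, ?_, hnd, fun z hz => hint z (hsub (.tail _ hz)) ?_ ?_⟩
  · rintro rfl
    simp [hux] at hlast
  · rintro rfl
    exact hxJ hz
  · rintro rfl
    exact hy (.tail _ hz)

/-- The interior of a path that has an interior vertex. -/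
theorem exists_oreLinked_interior {S : Set V} {x y u : V} (p : G.Walk x y)
    (hp : p.IsPath) (hint : ∀ z ∈ p.support, z ≠ x → z ≠ y → z ∉ S) (hu : u ∈ p.support)
    (hux : u ≠ x) (huy : u ≠ y) :
    ∃ (a b : V) (I : List V), G.Adj x a ∧ OreLinked G a I b ∧ G.Adj b y ∧ I ≠ [] ∧ I.Nodup ∧
      ∀ z ∈ I, z ∉ S := by
  cases p with
  | nil => simp [hux] at hu
  | @cons _ a _ hxa q =>
    rw [Walk.cons_isPath_iff] at hp
    have hya : y ≠ a := by
      rintro rfl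
      rw [Walk.eq_nil_iff_nil.2 (Walk.isPath_iff_nil.1 hp.1)] at hu
      simp [hux, huy] at hu
    obtain ⟨b, I, hyb, hlink, hsupp⟩ := OreLinked.exists_support_eq_cons q.reverse hya
    have hnd := hp.1.reverse.support_nodup
    have hmem (z : V) : z ∈ y :: I ↔ z ∈ q.support := by
      rw [← hsupp, Walk.support_reverse, List.mem_reverse]
    rw [hsupp, List.nodup_cons] at hnd
    refine ⟨a, b, I.reverse, hxa, hlink.reverse, hyb.symm, ?_, List.nodup_reverse.2 hnd.2,
      fun z hz => ?_⟩
    · intro h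
      rw [List.reverse_eq_nil_iff] at h
      have := (hmem a).2 q.start_mem_support
      simp [h, hya.symm] at this
    · rw [List.mem_reverse] at hz
      have hzq := (hmem z).1 (.tail _ hz)
      refine hint z (.tail _ hzq) ?_ ?_
      · rintro rfl
        exact hp.2 hzq
      · rintro rfl
        exact hnd.1 hz

end OrePaths

/-- **Lemma 3(f) of the paper.** `G` 2-connected, o-heavy and non-Hamiltonian,
`C` a longest heavy cycle given by `f`, and `p` a path between the vertices
`f i₁` and `f i₂` of `C` whose internal vertices avoid `C`. Let
`y₁ = f (i₁ + t₁)` be the first vertex on the arc of `C` from `f i₁` to `f i₂`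
nonadjacent to `f i₁`, and `y₂ = f (i₂ + t₂)` the first vertex on the arc from
`f i₂` to `f i₁` nonadjacent to `f i₂`. Then for every internal vertex `u` of
`p`, every `w₁ = f (i₁ + s₁)` on the arc from `(f i₁)⁺` to `y₁` and every
`w₂ = f (i₂ + s₂)` on the arc from `(f i₂)⁺` to `y₂`, none of `{u, w₁}`,
`{u, w₂}`, `{f i₁, w₂}`, `{f i₂, w₁}`, `{w₁, w₂}` is an Ore-edge. -/
theorem lemma3f {V : Type*} [Fintype V] [DecidableEq V]
    (G : SimpleGraph V) [DecidableRel G.Adj]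
    (h2 : TwoConnected G) (hoh : OHeavy G)
    (hnh : ¬G.IsHamiltonian)
    (m : ℕ) (f : ZMod m → V) (hC : IsLongestCycle G m f)
    (hheavyC : ∀ x : V, Fintype.card V ≤ 2 * G.degree x → x ∈ Set.range f)
    (i1 i2 : ZMod m) (hne : i1 ≠ i2)
    (p : G.Walk (f i1) (f i2)) (hp : p.IsPath)
    (hint : ∀ x ∈ p.support, x ≠ f i1 → x ≠ f i2 → x ∉ Set.range f)
    (t1 t2 : ℕ)
    (ht1pos : 1 ≤ t1) (ht1le : t1 ≤ (i2 - i1).val)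
    (hy1 : ¬G.Adj (f i1) (f (i1 + (t1 : ZMod m))))
    (hfirst1 : ∀ s : ℕ, 1 ≤ s → s < t1 → G.Adj (f i1) (f (i1 + (s : ZMod m))))
    (ht2pos : 1 ≤ t2) (ht2le : t2 ≤ (i1 - i2).val)
    (hy2 : ¬G.Adj (f i2) (f (i2 + (t2 : ZMod m))))
    (hfirst2 : ∀ s : ℕ, 1 ≤ s → s < t2 → G.Adj (f i2) (f (i2 + (s : ZMod m))))
    (u : V) (hu : u ∈ p.support) (hu1 : u ≠ f i1) (hu2 : u ≠ f i2)
    (s1 s2 : ℕ) (hs1 : 1 ≤ s1) (hs1' : s1 ≤ t1) (hs2 : 1 ≤ s2) (hs2' : s2 ≤ t2) :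
    ¬OreEdge G u (f (i1 + (s1 : ZMod m))) ∧
    ¬OreEdge G u (f (i2 + (s2 : ZMod m))) ∧
    ¬OreEdge G (f i1) (f (i2 + (s2 : ZMod m))) ∧
    ¬OreEdge G (f i2) (f (i1 + (s1 : ZMod m))) ∧
    ¬OreEdge G (f (i1 + (s1 : ZMod m))) (f (i2 + (s2 : ZMod m))) := by
  have : NeZero m := ⟨by have := hC.1.1; omega⟩
  have hf := hC.1.2.2
  have hd : i2 = i1 + ((i2 - i1).val : ZMod m) := by simp
  have he : i1 = i2 + ((i1 - i2).val : ZMod m) := by simp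
  have hde : (i2 - i1).val + (i1 - i2).val = m := by
    rw [← neg_sub i2 i1, ZMod.neg_val, if_neg (sub_ne_zero.2 hne.symm)]
    have := ZMod.val_lt (i2 - i1)
    omega
  have hd0 : (i2 - i1).val ≠ 0 := by simpa [sub_eq_zero] using hne.symm
  have he0 : (i1 - i2).val ≠ 0 := by simpa [sub_eq_zero] using hne
  generalize (i2 - i1).val = d at *
  generalize (i1 - i2).val = e at *
  obtain ⟨a, b, I, h1a, hlink, hb2, hI, hnd, hoff⟩ :=
    exists_oreLinked_interior p hp hint hu hu1 hu2
  obtain ⟨c, J, h1c, hlinkJ, hJ, hndJ, hoffJ⟩ :=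
    exists_oreLinked_of_mem_support p hp hint hu hu1 hu2
  obtain ⟨c', J', h2c, hlinkJ', hJ', hndJ', hoffJ'⟩ :=
    exists_oreLinked_of_mem_support p.reverse hp.reverse
      (fun z hz hz2 hz1 => hint z (by simpa using hz) hz1 hz2) (by simpa using hu) hu2 hu1
  have hends : a ∉ Set.range f ∧ b ∉ Set.range f := by
    have hmem {x y : V} {l : List V} (h : OreLinked G x l y) : x ∈ l := by
      obtain ⟨_, h⟩ := h
      cases h <;> simp
    exact ⟨hoff a (hmem hlink), hoff b (by simpa using hmem hlink.reverse)⟩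
  have hore1 := hC.oreEdge_pred_succ hoh hends.1 h1a
  have hore2 := hC.oreEdge_pred_succ hoh hends.2 hb2.symm
  have hIr : I.reverse ≠ [] := by simpa using hI
  have hoffr : ∀ x ∈ I.reverse, x ∉ Set.range f := fun x hx => hoff x (by simpa using hx)
  have ht1 : t1 ≠ 1 := by
    rintro rfl
    exact hy1 (by simpa using hf i1)
  have ht2 : t2 ≠ 1 := by
    rintro rfl
    exact hy2 (by simpa using hf i2)
  have ht1d : t1 < d := by
    refine lt_of_le_of_ne ht1le fun h => ?_
    refine hC.not_adj_pred hd he hde (by omega) (by omega) hore1 hI hnd hoff h1a hlink hb2 ?_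
    have h' := hfirst1 (d - 1) (by omega) (by omega)
    rwa [Nat.cast_sub (by omega), ← add_sub_assoc, ← hd, Nat.cast_one] at h'
  have ht2e : t2 < e := by
    refine lt_of_le_of_ne ht2le fun h => ?_
    refine hC.not_adj_pred he hd (by omega) (by omega) (by omega) hore2 hIr
      (List.nodup_reverse.2 hnd) hoffr hb2.symm hlink.reverse h1a.symm ?_
    have h' := hfirst2 (e - 1) (by omega) (by omega)
    rwa [Nat.cast_sub (by omega), ← add_sub_assoc, ← he, Nat.cast_one] at h'
  have hadj1 : ∀ k : ℕ, 1 ≤ k → k < s1 → G.Adj (f i1) (f (i1 + k)) :=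
    fun k hk hks => hfirst1 k hk (by omega)
  have hadj2 : ∀ k : ℕ, 1 ≤ k → k < s2 → G.Adj (f i2) (f (i2 + k)) :=
    fun k hk hks => hfirst2 k hk (by omega)
  obtain ⟨huw1, hv1w2, hw1w2⟩ := hC.not_oreEdge_of_path hd he hde hore1 hore2 hI hnd hoff h1a hlink
    hb2 hJ hndJ hoffJ h1c hlinkJ hs1 (by omega) hs2 (by omega) hadj1 hadj2
  obtain ⟨huw2, hv2w1, -⟩ := hC.not_oreEdge_of_path he hd (by omega) hore2 hore1 hIr
    (List.nodup_reverse.2 hnd) hoffr hb2.symm hlink.reverse h1a.symm hJ' hndJ' hoffJ' h2c hlinkJ'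
    hs2 (by omega) hs1 (by omega) hadj2 hadj1
  exact ⟨huw1, huw2, hv1w2, hv2w1, hw1w2⟩
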